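/- arXiv:2102.00401 — 9 statements merged into one kernel-verified Lean document; each statement's English description precedes it below -/
import Mathlib

section
/- Let n be a positive integer, let X be a regular curve of almost ≤ n order, and let G be a group acting on X by homeomorphisms such that the action is sensitive. Then G contains a free noncommutative subsemigroup of rank 2; that is, there exist g1, g2 ∈ G such that any two distinct nonempty positive words in g1 and g2 represent distinct elements of G. -/
open Set Topology

/-- Boundary bumping: in a connected compact Hausdorff space, every component of the closure of an
open set with finite nonempty frontier meets the frontier. -/
theorem exists_frontier_mem_connectedComponent_closure {X : Type*} [TopologicalSpace X]
    [T2Space X] [CompactSpace X] [ConnectedSpace X] {V : Set X} (hV : IsOpen V)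
    (hfin : (frontier V).Finite) (hne : (frontier V).Nonempty) (x : closure V) :
    ∃ p : closure V, (p : X) ∈ frontier V ∧ p ∈ connectedComponent x := by
  have : CompactSpace (closure V) := isCompact_iff_compactSpace.mp isClosed_closure.isCompact
  by_contra! hcon
  have hsep : ∀ p : closure V, ∃ Z : Set (closure V), IsClopen Z ∧ x ∈ Z ∧
      ((p : X) ∈ frontier V → p ∉ Z) := by
    intro p
    by_cases hp : (p : X) ∈ frontier V
    · have h := hcon p hp
      rw [connectedComponent_eq_iInter_isClopen, mem_iInter, not_forall] at h
      obtain ⟨Z, hZ⟩ := h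
      exact ⟨Z, Z.2.1, Z.2.2, fun _ => hZ⟩
    · exact ⟨univ, isClopen_univ, mem_univ _, fun h => absurd h hp⟩
  choose Z hZ hxZ hpZ using hsep
  have hfin' : {p : closure V | (p : X) ∈ frontier V}.Finite :=
    hfin.preimage Subtype.val_injective.injOn
  set W : Set (closure V) := ⋂ p ∈ {p : closure V | (p : X) ∈ frontier V}, Z p with hW
  have hWclopen : IsClopen W := hfin'.isClopen_biInter fun p _ => hZ p
  have hxW : x ∈ W := mem_iInter₂.mpr fun p _ => hxZ p
  have hWF : ∀ p ∈ W, (p : X) ∉ frontier V := fun p hp hpF =>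
    hpZ p hpF (mem_iInter₂.mp hp p hpF)
  have hclosed : IsClosed (Subtype.val '' W) :=
    isClosed_closure.isClosedEmbedding_subtypeVal.isClosedMap _ hWclopen.1
  have hopen : IsOpen (Subtype.val '' W) := by
    obtain ⟨O, hO, hOW⟩ := isOpen_induced_iff.mp hWclopen.2
    have : Subtype.val '' W = V ∩ O := by
      ext y
      constructor
      · rintro ⟨p, hp, rfl⟩
        refine ⟨?_, by rw [← hOW] at hp; exact hp⟩
        by_contra hpV
        refine hWF p hp ⟨p.2, ?_⟩
        rwa [hV.interior_eq]
      · rintro ⟨hyV, hyO⟩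
        exact ⟨⟨y, subset_closure hyV⟩, by rw [← hOW]; exact hyO, rfl⟩
    rw [this]
    exact hV.inter hO
  have huniv : Subtype.val '' W = univ :=
    IsClopen.eq_univ ⟨hclosed, hopen⟩ ⟨x, x, hxW, rfl⟩
  obtain ⟨q, hq⟩ := hne
  obtain ⟨p, hp, rfl⟩ : q ∈ Subtype.val '' W := huniv ▸ mem_univ q
  exact hWF p hp hq

/-- A regular curve is locally connected. -/
theorem locallyConnectedSpace_of_finite_frontier_basis {X : Type*} [TopologicalSpace X]
    [T2Space X] [CompactSpace X] [ConnectedSpace X]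
    (hreg : ∀ (x : X) (U : Set X), IsOpen U → x ∈ U →
      ∃ V : Set X, IsOpen V ∧ x ∈ V ∧ V ⊆ U ∧ (frontier V).Finite) :
    LocallyConnectedSpace X := by
  rw [locallyConnectedSpace_iff_connected_subsets]
  intro x U hU
  obtain ⟨C, hC, hCclosed, hCU⟩ := exists_mem_nhds_isClosed_subset hU
  obtain ⟨V, hV, hxV, hVC, hfin⟩ :=
    hreg x (interior C) isOpen_interior (mem_interior_iff_mem_nhds.mpr hC)
  have hVU : closure V ⊆ U :=
    (closure_minimal (hVC.trans interior_subset) hCclosed).trans hCU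
  rcases (frontier V).eq_empty_or_nonempty with hempty | hne
  · have hVuniv : V = univ :=
      (frontier_eq_empty_iff.mp hempty).resolve_left (Set.nonempty_of_mem hxV).ne_empty
    exact ⟨V, hV.mem_nhds hxV, hVuniv ▸ isPreconnected_univ, subset_closure.trans hVU⟩
  let x' : closure V := ⟨x, subset_closure hxV⟩
  have hbump := exists_frontier_mem_connectedComponent_closure hV hfin hne
  have hfin' : {p : closure V | (p : X) ∈ frontier V}.Finite :=
    hfin.preimage Subtype.val_injective.injOn
  have hopen : IsOpen (connectedComponent x') := by
    rw [← isClosed_compl_iff]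
    have : (connectedComponent x')ᶜ =
        ⋃ p ∈ {p : closure V | (p : X) ∈ frontier V} ∩ (connectedComponent x')ᶜ,
          connectedComponent p := by
      ext y
      simp only [mem_iUnion, exists_prop]
      constructor
      · intro hy
        obtain ⟨p, hpF, hpy⟩ := hbump y
        have h := connectedComponent_eq hpy
        refine ⟨p, ⟨hpF, fun hpx => hy ?_⟩, h ▸ mem_connectedComponent⟩
        rw [connectedComponent_eq hpx, ← h]
        exact mem_connectedComponent
      · rintro ⟨p, ⟨-, hpx⟩, hyp⟩ hyx
        refine hpx ?_
        rw [connectedComponent_eq hyx, ← connectedComponent_eq hyp]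
        exact mem_connectedComponent
    rw [this]
    exact (hfin'.inter_of_left _).isClosed_biUnion fun p _ => isClosed_connectedComponent
  refine ⟨Subtype.val '' connectedComponent x', ?_,
    isPreconnected_connectedComponent.image _ continuous_subtype_val.continuousOn, ?_⟩
  · have hK : closure V ∈ 𝓝 x := Filter.mem_of_superset (hV.mem_nhds hxV) subset_closure
    rw [← map_nhds_subtype_coe_eq_nhds (subset_closure hxV) hK]
    exact Filter.image_mem_map (hopen.mem_nhds mem_connectedComponent)
  · rintro _ ⟨p, -, rfl⟩
    exact hVU p.2

theorem frontier_connectedComponentIn_subset {X : Type*} [TopologicalSpace X]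
    [LocallyConnectedSpace X] {V : Set X} (hV : IsOpen V) (x : X) :
    frontier (connectedComponentIn V x) ⊆ frontier V := by
  intro p hp
  refine ⟨closure_mono (connectedComponentIn_subset V x) hp.1, fun hpV => ?_⟩
  rw [hV.interior_eq] at hpV
  obtain ⟨y, hyp, hyx⟩ := mem_closure_iff.mp hp.1 _ hV.connectedComponentIn
    (mem_connectedComponentIn hpV)
  refine hp.2 ?_
  rw [hV.connectedComponentIn.interior_eq, connectedComponentIn_eq hyx,
    ← connectedComponentIn_eq hyp]
  exact mem_connectedComponentIn hpV

/-- A connected set covered by `n` closed balls of radius `r` has diameter at most `2 * n * r`. -/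
theorem IsPreconnected.dist_le_of_subset_biUnion_closedBall {X : Type*} [PseudoMetricSpace X]
    {s : Set X} (hs : IsPreconnected s) (F : Finset X) {r : ℝ} (hr : 0 ≤ r)
    (hF : ∀ y ∈ s, ∃ p ∈ F, dist y p ≤ r) {x y : X} (hx : x ∈ s) (hy : y ∈ s) :
    dist x y ≤ F.card * (2 * r) := by
  have hIcc : Icc 0 (dist x y) ⊆ (fun z => dist x z) '' s := by
    have := hs.intermediate_value hx hy (f := fun z => dist x z)
      (continuous_const.dist continuous_id).continuousOn
    simpa using this
  have hcover : Icc 0 (dist x y) ⊆ ⋃ p ∈ F, Metric.closedBall (dist x p) r := by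
    intro t ht
    obtain ⟨z, hz, rfl⟩ := hIcc ht
    obtain ⟨p, hp, hzp⟩ := hF z hz
    refine mem_iUnion₂.mpr ⟨p, hp, ?_⟩
    have := dist_dist_dist_le_right x z p
    exact this.trans hzp
  have hmeas := (MeasureTheory.measure_mono (μ := MeasureTheory.volume) hcover).trans
    (MeasureTheory.measure_biUnion_finset_le F _)
  simp only [Real.volume_Icc, Real.volume_closedBall, Finset.sum_const, sub_zero,
    nsmul_eq_mul] at hmeas
  rwa [← ENNReal.ofReal_natCast, ← ENNReal.ofReal_mul (by positivity),
    ENNReal.ofReal_le_ofReal_iff (by positivity)] at hmeas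

/-- In a compact locally connected metric space, there are finitely many nonempty open sets such
that every open connected set of diameter larger than `c` and with at most `n` frontier points
contains one of them. -/
theorem exists_finite_open_family_subset_of_diam {X : Type*} [MetricSpace X] [CompactSpace X]
    [LocallyConnectedSpace X] (n : ℕ) {c : ℝ} (hc : 0 < c) :
    ∃ S : Set (Set X), S.Finite ∧ (∀ W ∈ S, IsOpen W ∧ W.Nonempty) ∧
      ∀ V : Set X, IsOpen V → IsPreconnected V → (frontier V).Finite → (frontier V).ncard ≤ n →
        c < Metric.diam V → ∃ W ∈ S, W ⊆ V := by
  set r : ℝ := c / (2 * (n + 1)) with hr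
  have hr0 : 0 < r := by positivity
  have hloc : ∀ x : X, ∃ W : Set X, W ⊆ Metric.ball x (r / 2) ∧ IsOpen W ∧ x ∈ W ∧
      IsConnected W := fun x =>
    locallyConnectedSpace_iff_subsets_isOpen_isConnected.mp inferInstance x _
      (Metric.ball_mem_nhds x (by positivity))
  choose W hWball hWopen hxW hWconn using hloc
  obtain ⟨T, hT⟩ := isCompact_univ.elim_finite_subcover W hWopen
    fun x _ => mem_iUnion.mpr ⟨x, hxW x⟩
  refine ⟨W '' T, T.finite_toSet.image W, ?_, ?_⟩
  · rintro _ ⟨x, -, rfl⟩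
    exact ⟨hWopen x, x, hxW x⟩
  intro V hVopen hVconn hfin hcard hdiam
  by_contra! hcon
  have hclose : ∀ y ∈ V, ∃ p ∈ hfin.toFinset, dist y p ≤ r := by
    intro y hy
    obtain ⟨x, hxT, hyx⟩ := mem_iUnion₂.mp (hT (mem_univ y))
    have hnot := hcon (W x) ⟨x, hxT, rfl⟩
    obtain ⟨p, ⟨hpV, hpW⟩, hp⟩ : ∃ p ∈ closure V ∩ W x, p ∉ V := by
      by_contra! h
      exact hnot ((hWconn x).isPreconnected.subset_of_closure_inter_subset hVopen
        ⟨y, hyx, hy⟩ h)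
    refine ⟨p, hfin.mem_toFinset.mpr ⟨hpV, by rwa [hVopen.interior_eq]⟩, ?_⟩
    have h1 := Metric.mem_ball.mp (hWball x hyx)
    have h2 := Metric.mem_ball.mp (hWball x hpW)
    have h3 := dist_triangle_right y p x
    linarith
  have hle : Metric.diam V ≤ hfin.toFinset.card * (2 * r) :=
    Metric.diam_le_of_forall_dist_le (by positivity) fun x hx y hy =>
      hVconn.dist_le_of_subset_biUnion_closedBall _ hr0.le hclose hx hy
  rw [← ncard_eq_toFinset_card _ hfin] at hle
  have hcard' : ((frontier V).ncard : ℝ) ≤ n := by exact_mod_cast hcard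
  have hrc : (n + 1) * (2 * r) = c := by
    rw [hr]
    field_simp
  nlinarith

/-- Ping-pong lemma for semigroups. -/
theorem injective_prod_map_of_pingPong {G X ι : Type*} [Group G] [MulAction G X] [Nontrivial ι]
    (g : ι → G) {W : Set X} (hne : W.Nonempty) (hmaps : ∀ i, ∀ x ∈ W, g i • x ∈ W)
    (hdisj : ∀ i j, i ≠ j → ∀ x ∈ W, ∀ y ∈ W, g i • x ≠ g j • y) :
    Function.Injective fun w : List ι => (w.map g).prod := by
  have hprod : ∀ w : List ι, ∀ x ∈ W, (w.map g).prod • x ∈ W := by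
    intro w
    induction w with
    | nil => simp
    | cons i w ih =>
      intro x hx
      simpa [mul_smul] using hmaps i _ (ih x hx)
  obtain ⟨x, hx⟩ := hne
  have hone : ∀ i w, ((i :: w : List ι).map g).prod ≠ 1 := by
    intro i w h
    obtain ⟨j, hj⟩ := exists_ne i
    have hjx := hmaps j x hx
    refine hdisj i j hj.symm _ (hprod w _ hjx) x hx ?_
    rw [← mul_smul, ← List.prod_cons, ← List.map_cons, h, one_smul]
  intro w₁
  induction w₁ with
  | nil =>
    rintro (_ | ⟨j, v⟩) h
    · rfl
    · exact absurd h.symm (hone j v)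
  | cons i u ih =>
    rintro (_ | ⟨j, v⟩) h
    · exact absurd h (hone i u)
    · simp only [List.map_cons, List.prod_cons] at h
      by_cases hij : i = j
      · subst hij
        rw [ih (mul_left_cancel h)]
      · refine absurd ?_ (hdisj i j hij _ (hprod u x hx) _ (hprod v x hx))
        rw [← mul_smul, h, mul_smul]

/-- If every nonempty open set contains a translate of one of finitely many nonempty open sets, then
some nonempty open set has a translate inside each of its nonempty open subsets. -/
theorem exists_isOpen_forall_open_subset_contains_translate {G X : Type*} [TopologicalSpace X]
    [Nonempty X] [Group G] [MulAction G X] {S : Set (Set X)} (hfin : S.Finite)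
    (hS : ∀ W ∈ S, IsOpen W ∧ W.Nonempty)
    (hcontract : ∀ O : Set X, IsOpen O → O.Nonempty → ∃ W ∈ S, ∃ g : G, ∀ x ∈ W, g • x ∈ O) :
    ∃ W : Set X, IsOpen W ∧ W.Nonempty ∧ ∀ O : Set X, IsOpen O → O.Nonempty → O ⊆ W →
      ∃ g : G, ∀ x ∈ W, g • x ∈ O := by
  obtain ⟨W₀, hW₀, -⟩ := hcontract univ isOpen_univ univ_nonempty
  obtain ⟨W, hW, hmin⟩ := hfin.exists_minimalFor
    (fun A : Set X => {B : Set X | ∃ g : G, ∀ x ∈ B, g • x ∈ A}) S ⟨W₀, hW₀⟩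
  refine ⟨W, (hS W hW).1, (hS W hW).2, fun O hO hne hOW => ?_⟩
  obtain ⟨W', hW', g, hg⟩ := hcontract O hO hne
  obtain ⟨h, hh⟩ := hmin hW' (fun B ⟨k, hk⟩ =>
    ⟨g * k, fun x hx => by rw [mul_smul]; exact hOW (hg _ (hk x hx))⟩)
    (show W ∈ {B : Set X | ∃ g : G, ∀ x ∈ B, g • x ∈ W} from
      ⟨1, fun x hx => by rwa [one_smul]⟩)
  exact ⟨g * h, fun x hx => by rw [mul_smul]; exact hg _ (hh x hx)⟩

/-- If a group `G` acts sensitively by homeomorphisms on a regular curve `X`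
of almost `≤ n` order, then `G` contains a free noncommutative subsemigroup of rank 2:
there are `g1 g2 : G` such that distinct nonempty positive words in `g1, g2`
represent distinct elements of `G`. -/
theorem sensitive_action_on_regular_curve_gives_free_subsemigroup
    {X : Type*} [MetricSpace X] [CompactSpace X] [ConnectedSpace X]
    (hreg : ∀ (x : X) (U : Set X), IsOpen U → x ∈ U →
      ∃ V : Set X, IsOpen V ∧ x ∈ V ∧ V ⊆ U ∧ (frontier V).Finite)
    (n : ℕ) (hn : 0 < n)
    (horder : ∀ U : Set X, IsOpen U → U.Nonempty →
      ∃ V : Set X, IsOpen V ∧ V.Nonempty ∧ V ⊆ U ∧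
        (frontier V).Finite ∧ (frontier V).ncard ≤ n)
    {G : Type*} [Group G] [MulAction G X]
    (hcont : ∀ g : G, Continuous fun x : X => g • x)
    (hsens : ∃ c > (0 : ℝ), ∀ U : Set X, IsOpen U → U.Nonempty →
      ∃ g : G, c < Metric.diam ((fun x => g • x) '' U)) :
    ∃ g1 g2 : G, ∀ w1 w2 : List (Fin 2), w1 ≠ [] → w2 ≠ [] → w1 ≠ w2 →
      (w1.map ![g1, g2]).prod ≠ (w2.map ![g1, g2]).prod := by
  obtain ⟨c, hc, hsens⟩ := hsens
  have : ContinuousConstSMul G X := ⟨hcont⟩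
  have := locallyConnectedSpace_of_finite_frontier_basis hreg
  obtain ⟨S, hSfin, hS, hbig⟩ := exists_finite_open_family_subset_of_diam (X := X) n hc
  have hcontract : ∀ O : Set X, IsOpen O → O.Nonempty →
      ∃ W ∈ S, ∃ g : G, ∀ x ∈ W, g • x ∈ O := by
    intro O hO hne
    obtain ⟨V, hV, ⟨x, hx⟩, hVO, hfin, hcard⟩ := horder O hO hne
    have hfront := frontier_connectedComponentIn_subset hV x
    obtain ⟨g, hg⟩ := hsens (connectedComponentIn V x) hV.connectedComponentIn
      ⟨x, mem_connectedComponentIn hx⟩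
    have himage : (fun x => g • x) '' frontier (connectedComponentIn V x) =
        frontier ((fun x => g • x) '' connectedComponentIn V x) :=
      (Homeomorph.smul g).image_frontier _
    have hfin' := hfin.subset hfront
    obtain ⟨W, hW, hWsub⟩ := hbig ((fun x => g • x) '' connectedComponentIn V x)
      ((Homeomorph.smul g).isOpenMap _ hV.connectedComponentIn)
      (isPreconnected_connectedComponentIn.image _ (hcont g).continuousOn)
      (himage ▸ hfin'.image _)
      (himage ▸ (Set.ncard_image_le hfin').trans ((Set.ncard_le_ncard hfront hfin).trans hcard))
      hg
    refine ⟨W, hW, g⁻¹, fun y hy => ?_⟩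
    obtain ⟨z, hz, rfl⟩ := hWsub hy
    simpa using hVO (connectedComponentIn_subset V x hz)
  obtain ⟨W, hWopen, hWne, hW⟩ :=
    exists_isOpen_forall_open_subset_contains_translate hSfin hS hcontract
  obtain ⟨a, ha, b, hb, hab⟩ : W.Nontrivial := by
    obtain ⟨g, hg⟩ := hsens W hWopen hWne
    by_contra h
    have hsub := (Set.not_nontrivial_iff.mp h).image fun x => g • x
    rw [Metric.diam_subsingleton hsub] at hg
    exact absurd hg hc.not_gt
  obtain ⟨A, B, hA, hB, haA, hbB, hAB⟩ := t2_separation hab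
  obtain ⟨g₁, hg₁⟩ := hW (W ∩ A) (hWopen.inter hA) ⟨a, ha, haA⟩ Set.inter_subset_left
  obtain ⟨g₂, hg₂⟩ := hW (W ∩ B) (hWopen.inter hB) ⟨b, hb, hbB⟩ Set.inter_subset_left
  refine ⟨g₁, g₂, fun w₁ w₂ _ _ hw => fun h => hw ?_⟩
  refine injective_prod_map_of_pingPong ![g₁, g₂] hWne ?_ ?_ h
  · rw [Fin.forall_fin_two]
    exact ⟨fun x hx => (hg₁ x hx).1, fun x hx => (hg₂ x hx).1⟩
  · have hne : ∀ x ∈ W, ∀ y ∈ W, g₁ • x ≠ g₂ • y := fun x hx y hy =>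
      hAB.ne_of_mem (hg₁ x hx).2 (hg₂ y hy).2
    simp only [Fin.forall_fin_two]
    exact ⟨⟨fun h => absurd rfl h, fun _ => hne⟩,
      fun _ x hx y hy => (hne y hy x hx).symm, fun h => absurd rfl h⟩
end

section
/- Let X be a regular curve and let U be a connected open subset of X whose boundary ∂_X(U) has exactly n points, for some positive integer n. If diam(U) > ε for some ε > 0, then there is a connected open set V ⊆ U such that dist(V, ∂_X(U)) ≥ ε/(4n) and diam(V) ≥ ε/(4n). -/
open Set Metric Topology in
/-- The diameter of a preconnected set covered by finitely many balls of radius `r` is at most the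
sum of the diameters of the balls. -/
theorem IsPreconnected.dist_le_of_subset_biUnion_ball {X : Type*} [PseudoMetricSpace X]
    {U : Set X} (hU : IsPreconnected U) {F : Finset X} {r : ℝ} (hr : 0 ≤ r)
    (hcover : U ⊆ ⋃ p ∈ F, ball p r) {a b : X} (ha : a ∈ U) (hb : b ∈ U) :
    dist a b ≤ F.card * (2 * r) := by
  have himage : IsPreconnected (dist a '' U) :=
    hU.image _ (continuous_const.dist continuous_id).continuousOn
  have hIcc : Icc 0 (dist a b) ⊆ ⋃ p ∈ F, ball (dist a p) r := by
    intro t ht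
    obtain ⟨y, hy, rfl⟩ := himage.Icc_subset ⟨a, ha, dist_self a⟩ ⟨b, hb, rfl⟩ ht
    obtain ⟨p, hp, hyp⟩ := mem_iUnion₂.mp (hcover hy)
    refine mem_iUnion₂.mpr ⟨p, hp, lt_of_le_of_lt ?_ (mem_ball.mp hyp)⟩
    rw [Real.dist_eq, dist_comm a y, dist_comm a p]
    exact abs_dist_sub_le y p a
  have hvol := (MeasureTheory.measure_mono (μ := MeasureTheory.volume) hIcc).trans
    (MeasureTheory.measure_biUnion_finset_le F _)
  simp only [Real.volume_Icc, Real.volume_ball, sub_zero, Finset.sum_const, nsmul_eq_mul] at hvol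
  rw [← ENNReal.ofReal_natCast, ← ENNReal.ofReal_mul (Nat.cast_nonneg _)] at hvol
  exact (ENNReal.ofReal_le_ofReal_iff (by positivity)).mp hvol

open Set in
/-- In a connected space, the closure of an open set with finite frontier has finitely many
connected components. -/
theorem IsOpen.finite_connectedComponents_closure {X : Type*} [TopologicalSpace X]
    [PreconnectedSpace X] {V : Set X} (hV : IsOpen V) (hfin : (frontier V).Finite) :
    Finite (ConnectedComponents (closure V)) := by
  by_contra hinf
  rw [not_finite_iff_infinite] at hinf
  obtain ⟨P, hclopen, hne, hdisj, -⟩ :=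
    ConnectedComponents.exists_fun_isClopen_of_infinite (closure V) ((frontier V).ncard + 2) (by omega)
  have hmeets : ∀ i, ∃ x ∈ frontier V, ∃ hx : x ∈ closure V, (⟨x, hx⟩ : closure V) ∈ P i := by
    by_contra! ⟨i, hi⟩
    have hsub : (↑) '' P i ⊆ V := by
      rintro _ ⟨⟨x, hx⟩, hxP, rfl⟩
      by_contra hxV
      exact hi x (by rw [hV.frontier_eq]; exact ⟨hx, hxV⟩) hx hxP
    have hclosed : IsClosed ((↑) '' P i : Set X) := (hclopen i).isClosed.trans isClosed_closure
    have hopen : IsOpen ((↑) '' P i : Set X) := by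
      obtain ⟨W, hW, hWP⟩ := isOpen_induced_iff.mp (hclopen i).isOpen
      have : ((↑) '' P i : Set X) = W ∩ V := by
        apply Subset.antisymm
        · refine subset_inter ?_ hsub
          rw [← hWP]
          exact image_preimage_subset _ _
        · rintro x ⟨hxW, hxV⟩
          exact ⟨⟨x, subset_closure hxV⟩, hWP ▸ hxW, rfl⟩
      exact this ▸ hW.inter hV
    have huniv := IsClopen.eq_univ ⟨hclosed, hopen⟩ ((hne i).image _)
    obtain ⟨j, hj⟩ := exists_ne i
    obtain ⟨y, hy⟩ := hne j
    obtain ⟨z, hz, hzy⟩ : (y : X) ∈ ((↑) '' P i : Set X) := huniv ▸ mem_univ _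
    exact disjoint_left.mp (hdisj hj) hy (Subtype.ext hzy ▸ hz)
  choose f hfV hfcl hfP using hmeets
  have hinj : Function.Injective f := by
    intro i j hij
    by_contra hne
    refine disjoint_left.mp (hdisj hne) (hfP i) ?_
    have : (⟨f i, hfcl i⟩ : closure V) = ⟨f j, hfcl j⟩ := Subtype.ext hij
    exact this ▸ hfP j
  have hcard := ncard_le_ncard (range_subset_iff.mpr hfV) hfin
  rw [← image_univ, ncard_image_of_injective _ hinj, ncard_univ, Nat.card_fin] at hcard
  omega

open Set Topology in
/-- A compact connected Hausdorff space having a basis of open sets with finite frontiers is locally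
connected. -/
theorem locallyConnectedSpace_of_finite_frontier {X : Type*} [TopologicalSpace X] [T2Space X]
    [CompactSpace X] [PreconnectedSpace X]
    (hreg : ∀ (x : X) (U : Set X), IsOpen U → x ∈ U →
      ∃ V : Set X, IsOpen V ∧ x ∈ V ∧ V ⊆ U ∧ (frontier V).Finite) :
    LocallyConnectedSpace X := by
  rw [locallyConnectedSpace_iff_connected_subsets]
  intro x U hU
  obtain ⟨W, hW, hWclosed, hWU⟩ := exists_mem_nhds_isClosed_subset hU
  obtain ⟨V, hV, hxV, hVW, hfin⟩ :=
    hreg x (interior W) isOpen_interior (mem_interior_iff_mem_nhds.mpr hW)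
  have hVU : closure V ⊆ U :=
    (closure_minimal (hVW.trans interior_subset) hWclosed).trans hWU
  have : CompactSpace (closure V) := isCompact_iff_compactSpace.mp isClosed_closure.isCompact
  have := hV.finite_connectedComponents_closure hfin
  have hopen := ConnectedComponents.discreteTopology_iff.mp
    (inferInstance : DiscreteTopology (ConnectedComponents (closure V)))
  have hx : x ∈ closure V := subset_closure hxV
  refine ⟨(↑) '' connectedComponent (⟨x, hx⟩ : closure V), ?_,
    isPreconnected_connectedComponent.image _ continuous_subtype_val.continuousOn, ?_⟩
  · rw [← map_nhds_subtype_coe_eq_nhds hx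
      (Filter.mem_of_superset (hV.mem_nhds hxV) subset_closure)]
    exact Filter.image_mem_map ((hopen _).mem_nhds mem_connectedComponent)
  · rintro _ ⟨y, -, rfl⟩
    exact hVU y.2

open Set in
/-- A point of the closure of a connected component of `O` that lies in `O` is in the component. -/
theorem closure_connectedComponentIn_inter_subset {X : Type*} [TopologicalSpace X] {O : Set X}
    {x : X} (hx : x ∈ O) :
    closure (connectedComponentIn O x) ∩ O ⊆ connectedComponentIn O x := by
  refine IsPreconnected.subset_connectedComponentIn ?_
    ⟨subset_closure (mem_connectedComponentIn hx), hx⟩ inter_subset_right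
  exact isPreconnected_connectedComponentIn.subset_closure
    (subset_inter subset_closure (connectedComponentIn_subset O x)) inter_subset_left


/-- In a regular curve `X`, if `U` is a connected open set whose boundary has
exactly `n` points and `diam U > ε`, then there is a connected open `V ⊆ U` with
`dist(V, ∂U) ≥ ε/(4n)` and `diam V ≥ ε/(4n)`. -/
theorem exists_large_subcontinuum_far_from_boundary
    {X : Type*} [MetricSpace X] [CompactSpace X] [ConnectedSpace X]
    (hreg : ∀ (x : X) (U : Set X), IsOpen U → x ∈ U →
      ∃ V : Set X, IsOpen V ∧ x ∈ V ∧ V ⊆ U ∧ (frontier V).Finite)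
    (n : ℕ) (hn : 0 < n) (U : Set X) (hUopen : IsOpen U) (hUconn : IsConnected U)
    (hUbd : (frontier U).ncard = n)
    (ε : ℝ) (hε : 0 < ε) (hdiam : ε < Metric.diam U) :
    ∃ V : Set X, IsOpen V ∧ IsConnected V ∧ V ⊆ U ∧
      (∀ x ∈ V, ∀ y ∈ frontier U, ε / (4 * n) ≤ dist x y) ∧
      ε / (4 * n) ≤ Metric.diam V := by
  have : LocallyConnectedSpace X := locallyConnectedSpace_of_finite_frontier hreg
  have hn' : (0 : ℝ) < n := by exact_mod_cast hn
  have hFfin : (frontier U).Finite := Set.finite_of_ncard_pos (hUbd ▸ hn)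
  have hFne : (frontier U).Nonempty := Set.nonempty_of_ncard_ne_zero (by omega)
  set δ : ℝ := ε / (4 * n) with hδ
  have hδpos : 0 < δ := by positivity
  set O : Set X := U ∩ {x | δ < Metric.infDist x (frontier U)} with hO
  have hOopen : IsOpen O :=
    hUopen.inter (isOpen_lt continuous_const (Metric.continuous_infDist_pt _))
  by_contra! hsmall
  have hnear : ∀ x ∈ U, Metric.infDist x (frontier U) < 2 * δ := by
    intro x hxU
    by_cases hx : δ < Metric.infDist x (frontier U)
    swap
    · linarith
    have hxO : x ∈ O := ⟨hxU, hx⟩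
    set C := connectedComponentIn O x with hC
    have hCO : C ⊆ O := connectedComponentIn_subset O x
    have hxC : x ∈ C := mem_connectedComponentIn hxO
    have hdiamC : Metric.diam C < δ := by
      refine hsmall C hOopen.connectedComponentIn ⟨⟨x, hxC⟩, isPreconnected_connectedComponentIn⟩
        (hCO.trans Set.inter_subset_left) fun y hy z hz ↦ ?_
      exact (hCO hy).2.le.trans (Metric.infDist_le_dist_of_mem hz)
    obtain ⟨y, hyC, hyO⟩ : ∃ y ∈ closure C, y ∉ O := by
      by_contra! hsub
      have hclosed : IsClosed C := isClosed_of_closure_subset fun y hy ↦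
        closure_connectedComponentIn_inter_subset hxO ⟨hy, hsub y hy⟩
      have huniv := IsClopen.eq_univ ⟨hclosed, hOopen.connectedComponentIn⟩ ⟨x, hxC⟩
      have hU : U = Set.univ := Set.univ_subset_iff.mp
        (huniv ▸ hCO.trans Set.inter_subset_left)
      simp [hU] at hFne
    have hy : Metric.infDist y (frontier U) ≤ δ := by
      by_contra! hlt
      refine hyO ⟨?_, hlt⟩
      by_contra hyU
      have hyF : y ∈ frontier U := by
        rw [hUopen.frontier_eq]
        exact ⟨closure_mono (hCO.trans Set.inter_subset_left) hyC, hyU⟩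
      rw [Metric.infDist_zero_of_mem hyF] at hlt
      exact hlt.not_gt hδpos
    have hxy : dist x y ≤ Metric.diam C := by
      have hball : C ⊆ Metric.closedBall x (Metric.diam C) := fun z hz ↦
        Metric.dist_le_diam_of_mem (Bornology.IsBounded.all C) hz hxC
      rw [dist_comm]
      exact closure_minimal hball Metric.isClosed_closedBall hyC
    linarith [Metric.infDist_le_infDist_add_dist (x := x) (y := y) (s := frontier U)]
  have hcover : U ⊆ ⋃ p ∈ hFfin.toFinset, Metric.ball p (2 * δ) := by
    intro x hx
    obtain ⟨p, hp, hxp⟩ := (Metric.infDist_lt_iff hFne).mp (hnear x hx)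
    exact Set.mem_iUnion₂.mpr ⟨p, hFfin.mem_toFinset.mpr hp, hxp⟩
  refine hdiam.not_ge (Metric.diam_le_of_forall_dist_le hε.le fun a ha b hb ↦ ?_)
  have hdist := hUconn.isPreconnected.dist_le_of_subset_biUnion_ball (by positivity) hcover ha hb
  rw [← Set.ncard_eq_toFinset_card _ hFfin, hUbd] at hdist
  refine hdist.trans_eq ?_
  rw [hδ]
  field_simp
  norm_num
end

section
/- Let X be a regular curve, let n be a positive integer, and let (U_i)_{i=1}^∞ be a sequence of connected open subsets of X such that the boundary ∂_X(U_i) has exactly n points for each i. Suppose there is ε > 0 with diam(U_i) > ε for every i. Then there are a nonempty open set W ⊆ X and infinitely many indices i such that W ⊆ U_i. -/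
open Set Topology

/-- A preconnected set meeting an open set but not its frontier is contained in it. -/
theorem IsPreconnected.subset_of_disjoint_frontier {X : Type*} [TopologicalSpace X] {s u : Set X}
    (hs : IsPreconnected s) (hu : IsOpen u) (hne : (s ∩ u).Nonempty)
    (hd : Disjoint s (frontier u)) : s ⊆ u := by
  refine hs.subset_of_closure_inter_subset hu hne ?_
  rintro x ⟨hxc, hxs⟩
  by_contra hxu
  exact hd.notMem_of_mem_left hxs (by rw [hu.frontier_eq]; exact ⟨hxc, hxu⟩)

/-- In a connected compact Hausdorff space, a point of an open set with finite frontier has a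
preconnected neighborhood inside the closure of that open set. -/
theorem exists_isPreconnected_mem_nhds_of_finite_frontier {X : Type*} [TopologicalSpace X]
    [CompactSpace X] [T2Space X] [PreconnectedSpace X] {G : Set X} (hG : IsOpen G)
    (hfin : (frontier G).Finite) {p : X} (hp : p ∈ G) :
    ∃ C : Set X, IsPreconnected C ∧ C ∈ 𝓝 p ∧ C ⊆ closure G := by
  have : CompactSpace (closure G) := isCompact_iff_compactSpace.mp isClosed_closure.isCompact
  let p' : closure G := ⟨p, subset_closure hp⟩
  have hsep : ∀ q : closure G, q ∉ connectedComponent p' →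
      ∃ A : Set (closure G), IsClopen A ∧ p' ∈ A ∧ q ∉ A := by
    intro q hq
    rw [connectedComponent_eq_iInter_isClopen, mem_iInter] at hq
    push Not at hq
    obtain ⟨⟨A, hA, hpA⟩, hqA⟩ := hq
    exact ⟨A, hA, hpA, hqA⟩
  have hfin' : {b : closure G | (b : X) ∈ frontier G ∧ b ∉ connectedComponent p'}.Finite :=
    (hfin.preimage Subtype.val_injective.injOn).subset fun b hb => hb.1
  choose! A hAclopen hpA hqA using hsep
  let B : Set (closure G) :=
    ⋂ b ∈ {b : closure G | (b : X) ∈ frontier G ∧ b ∉ connectedComponent p'}, A b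
  have hB : IsClopen B := hfin'.isClopen_biInter fun b hb => hAclopen b hb.2
  have hpB : p' ∈ B := mem_iInter₂.mpr fun b hb => hpA b hb.2
  have hBC : B ⊆ connectedComponent p' := by
    intro q hqB
    by_contra hq
    have hD : IsClopen (B \ A q) := hB.diff (hAclopen q hq)
    have hDG : ∀ x ∈ B \ A q, (x : X) ∈ G := by
      rintro x ⟨hxB, hxA⟩
      by_contra hxG
      have hxF : (x : X) ∈ frontier G := by
        rw [hG.frontier_eq]; exact ⟨x.2, hxG⟩
      by_cases hxC : x ∈ connectedComponent p'
      · exact hxA ((hAclopen q hq).connectedComponent_subset (hpA q hq) hxC)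
      · exact hqA x hxC (mem_iInter₂.mp hxB x ⟨hxF, hxC⟩)
    have hclosed : IsClosed (Subtype.val '' (B \ A q)) :=
      isClosed_closure.isClosedMap_subtype_val _ hD.isClosed
    have hopen : IsOpen (Subtype.val '' (B \ A q)) := by
      obtain ⟨O, hO, hOD⟩ := isOpen_induced_iff.mp hD.isOpen
      have : Subtype.val '' (B \ A q) = O ∩ G := by
        ext x
        constructor
        · rintro ⟨y, hy, rfl⟩
          exact ⟨by rw [← hOD] at hy; exact hy, hDG y hy⟩
        · rintro ⟨hxO, hxG⟩
          exact ⟨⟨x, subset_closure hxG⟩, by rw [← hOD]; exact hxO, rfl⟩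
      rw [this]
      exact hO.inter hG
    have huniv := IsClopen.eq_univ ⟨hclosed, hopen⟩ ⟨_, mem_image_of_mem _ ⟨hqB, hqA q hq⟩⟩
    obtain ⟨y, hy, hyp⟩ := huniv.ge (mem_univ p)
    obtain rfl : y = p' := Subtype.ext hyp
    exact hy.2 (hpA q hq)
  refine ⟨Subtype.val '' connectedComponent p',
    isPreconnected_connectedComponent.image _ continuous_subtype_val.continuousOn, ?_, ?_⟩
  · have hmem : connectedComponent p' ∈ 𝓝 p' :=
      Filter.mem_of_superset (hB.isOpen.mem_nhds hpB) hBC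
    rw [← map_nhds_subtype_coe_eq_nhds (subset_closure hp)
      (Filter.mem_of_superset (hG.mem_nhds hp) subset_closure)]
    exact Filter.image_mem_map hmem
  · rintro _ ⟨y, -, rfl⟩
    exact y.2

/-- In a compact metric space with a basis of open sets with finite frontiers, some finite set
meets every connected set of large diameter in at least `m` points. -/
theorem exists_finite_set_forall_le_ncard_inter {X : Type*} [MetricSpace X] [CompactSpace X]
    (hreg : ∀ (x : X) (U : Set X), IsOpen U → x ∈ U →
      ∃ V : Set X, IsOpen V ∧ x ∈ V ∧ V ⊆ U ∧ (frontier V).Finite)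
    (m : ℕ) {ε : ℝ} (hε : 0 < ε) :
    ∃ F : Set X, F.Finite ∧ ∀ U : Set X, IsPreconnected U → ε < Metric.diam U →
      m ≤ (U ∩ F).ncard := by
  have hm : (0 : ℝ) < m + 1 := by positivity
  set η := ε / (m + 1) with hη
  have hη0 : 0 < η := div_pos hε hm
  have hηε : (m + 1) * η = ε := by rw [hη]; field_simp
  choose V hVopen hxV hVsub hVfin using fun x : X =>
    hreg x (Metric.ball x (η / 8)) Metric.isOpen_ball (Metric.mem_ball_self (by positivity))
  obtain ⟨t, ht⟩ := isCompact_univ.elim_finite_subcover V hVopen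
    fun x _ => mem_iUnion.mpr ⟨x, hxV x⟩
  refine ⟨⋃ x ∈ t, frontier (V x), t.finite_toSet.biUnion fun x _ => hVfin x, ?_⟩
  intro U hU hdiam
  obtain ⟨x, hx, y, hy, hxy⟩ : ∃ x ∈ U, ∃ y ∈ U, ε < dist x y := by
    by_contra! h
    exact hdiam.not_ge (Metric.diam_le_of_forall_dist_le hε.le h)
  have hpt : ∀ k : Fin m, ∃ q ∈ U ∩ ⋃ x ∈ t, frontier (V x),
      |dist x q - (k + 1) * η| ≤ η / 4 := by
    intro k
    have hk : ((k : ℕ) : ℝ) + 1 ≤ m := by exact_mod_cast k.2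
    have hr : ((k : ℕ) + 1) * η ∈ Icc (dist x x) (dist x y) := by
      rw [dist_self]
      exact ⟨by positivity, by nlinarith⟩
    obtain ⟨z, hzU, hz⟩ := hU.intermediate_value hx hy
      (f := fun z => dist x z) (by fun_prop) hr
    obtain ⟨c, hct, hzc⟩ := mem_iUnion₂.mp (ht (mem_univ z))
    have hnot : ¬ U ⊆ V c := by
      intro hsub
      have h1 := hVsub c (hsub hx)
      have h2 := hVsub c (hsub hy)
      rw [Metric.mem_ball] at h1 h2
      have := dist_triangle_right x y c
      nlinarith [Nat.cast_nonneg (α := ℝ) m]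
    have hnd : ¬ Disjoint U (frontier (V c)) := fun hd =>
      hnot (hU.subset_of_disjoint_frontier (hVopen c) ⟨z, hzU, hzc⟩ hd)
    obtain ⟨q, hqU, hqF⟩ := not_disjoint_iff.mp hnd
    refine ⟨q, ⟨hqU, mem_iUnion₂.mpr ⟨c, hct, hqF⟩⟩, ?_⟩
    have hqc : dist q c ≤ η / 8 := Metric.closure_ball_subset_closedBall
      (closure_mono (hVsub c) (frontier_subset_closure hqF))
    have hzc' : dist z c < η / 8 := hVsub c hzc
    have h1 := dist_triangle_right q z c
    have h2 := abs_dist_sub_le q z x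
    rw [dist_comm q x, dist_comm z x] at h2
    dsimp only at hz
    rw [← hz]
    linarith
  choose q hq hqd using hpt
  have hinj : Function.Injective q := by
    intro k l hkl
    have h1 := abs_le.mp (hqd k)
    have h2 := abs_le.mp (hqd l)
    rw [hkl] at h1
    rcases lt_trichotomy (k : ℕ) l with h | h | h
    · have : ((k : ℕ) : ℝ) + 1 ≤ (l : ℕ) := by exact_mod_cast h
      nlinarith
    · exact Fin.ext h
    · have : ((l : ℕ) : ℝ) + 1 ≤ (k : ℕ) := by exact_mod_cast h
      nlinarith
  have hfin : (U ∩ ⋃ x ∈ t, frontier (V x)).Finite :=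
    (t.finite_toSet.biUnion fun x _ => hVfin x).subset inter_subset_right
  calc m = (range q).ncard := by rw [← image_univ, ncard_image_of_injective _ hinj]; simp
    _ ≤ _ := ncard_le_ncard (range_subset_iff.mpr hq) hfin


/-- In a regular curve, given a sequence of connected open sets `U i`, each with
boundary of exactly `n` points and diameter `> ε`, there is a nonempty open set `W`
contained in `U i` for infinitely many `i`. -/
theorem exists_open_set_in_infinitely_many
    {X : Type*} [MetricSpace X] [CompactSpace X] [ConnectedSpace X]
    (hreg : ∀ (x : X) (U : Set X), IsOpen U → x ∈ U →
      ∃ V : Set X, IsOpen V ∧ x ∈ V ∧ V ⊆ U ∧ (frontier V).Finite)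
    (n : ℕ) (hn : 0 < n) (U : ℕ → Set X)
    (hopen : ∀ i, IsOpen (U i)) (hconn : ∀ i, IsConnected (U i))
    (hbd : ∀ i, (frontier (U i)).ncard = n)
    (ε : ℝ) (hε : 0 < ε) (hdiam : ∀ i, ε < Metric.diam (U i)) :
    ∃ W : Set X, IsOpen W ∧ W.Nonempty ∧ {i : ℕ | W ⊆ U i}.Infinite := by
  obtain ⟨F, hF, hFcard⟩ := exists_finite_set_forall_le_ncard_inter hreg (n + 1) hε
  have : Finite F := hF
  obtain ⟨T, hT⟩ := Finite.exists_infinite_fiber fun i => {x : F | (x : X) ∈ U i}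
  rw [infinite_coe_iff] at hT
  obtain ⟨i₀, hi₀⟩ := hT.nonempty
  have hTcard : n + 1 ≤ T.ncard := by
    have h := hFcard (U i₀) (hconn i₀).isPreconnected (hdiam i₀)
    rw [← hi₀]
    rwa [inter_comm, ← Subtype.image_preimage_coe,
      ncard_image_of_injective _ Subtype.val_injective] at h
  obtain ⟨O, hO, hdisj⟩ := hF.t2_separation
  have hC : ∀ x : F, ∃ C : Set X, IsPreconnected C ∧ C ∈ 𝓝 (x : X) ∧ C ⊆ O x := by
    intro x
    obtain ⟨K, hK, hKc, hKO⟩ :=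
      exists_mem_nhds_isClosed_subset ((hO x).2.mem_nhds (hO x).1)
    obtain ⟨V, hV, hxV, hVK, hVfin⟩ :=
      hreg x (interior K) isOpen_interior (mem_interior_iff_mem_nhds.mpr hK)
    obtain ⟨C, hC, hCx, hCV⟩ := exists_isPreconnected_mem_nhds_of_finite_frontier hV hVfin hxV
    exact ⟨C, hC, hCx,
      hCV.trans ((closure_minimal (hVK.trans interior_subset) hKc).trans hKO)⟩
  choose C hCconn hCx hCO using hC
  have hsub : ∀ i ∈ (fun i => {x : F | (x : X) ∈ U i}) ⁻¹' {T}, ∃ x : F, C x ⊆ U i := by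
    intro i hi
    by_contra! hnot
    have hmeet : ∀ x ∈ T, ∃ y ∈ frontier (U i), y ∈ C x := by
      intro x hx
      by_contra! hy
      rw [← show _ = T from hi] at hx
      exact hnot x ((hCconn x).subset_of_disjoint_frontier (hopen i)
        ⟨x, mem_of_mem_nhds (hCx x), hx⟩ (disjoint_right.mpr hy))
    choose! y hyF hyC using hmeet
    have hle : T.ncard ≤ (frontier (U i)).ncard := by
      refine ncard_le_ncard_of_injOn y hyF ?_ (finite_of_ncard_pos (by rw [hbd i]; exact hn))
      intro a ha b hb hab
      by_contra hne
      exact (hdisj a.2 b.2 (Subtype.coe_injective.ne hne)).notMem_of_mem_left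
        (hCO a (hyC a ha)) (hCO b (hab ▸ hyC b hb))
    rw [hbd i] at hle
    omega
  obtain ⟨x, hx⟩ : ∃ x : F, {i | C x ⊆ U i}.Infinite := by
    by_contra! hfin
    exact hT ((finite_iUnion hfin).subset fun i hi => mem_iUnion.mpr (hsub i hi))
  exact ⟨interior (C x), isOpen_interior, ⟨x, mem_interior_iff_mem_nhds.mpr (hCx x)⟩,
    hx.mono fun i hi => interior_subset.trans hi⟩
end

section
/- Let X be a regular curve. Then for every constant c > 0 there is a finite set A ⊆ X such that the diameter of each connected component of X \ A is at most c. -/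
/-- A preconnected set that meets an open set `V` and misses its frontier lies in `V`. -/
theorem IsPreconnected.subset_of_isOpen_of_disjoint_frontier {X : Type*} [TopologicalSpace X]
    {s V : Set X} (hs : IsPreconnected s) (hV : IsOpen V) (hsV : (s ∩ V).Nonempty)
    (hd : Disjoint s (frontier V)) : s ⊆ V := by
  refine hs.subset_left_of_subset_union hV isClosed_closure.isOpen_compl
    (Set.disjoint_compl_right_iff_subset.2 subset_closure) (fun y hy => ?_) hsV
  by_cases hyV : y ∈ V
  · exact Or.inl hyV
  · exact Or.inr fun hc => Set.disjoint_left.1 hd hy (hV.frontier_eq ▸ ⟨hc, hyV⟩)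

/-- In a regular curve `X`, for every `c > 0` there is a finite set `A ⊆ X`
such that every connected component of `X \ A` has diameter at most `c`. -/
theorem exists_finite_set_with_small_components
    {X : Type*} [MetricSpace X] [CompactSpace X] [ConnectedSpace X]
    (hreg : ∀ (x : X) (U : Set X), IsOpen U → x ∈ U →
      ∃ V : Set X, IsOpen V ∧ x ∈ V ∧ V ⊆ U ∧ (frontier V).Finite)
    (c : ℝ) (hc : 0 < c) :
    ∃ A : Set X, A.Finite ∧
      ∀ x ∈ Aᶜ, Metric.diam (connectedComponentIn Aᶜ x) ≤ c := by
  choose V hVo hxV hVU hVf using fun x : X =>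
    hreg x (Metric.ball x (c / 2)) Metric.isOpen_ball (Metric.mem_ball_self (half_pos hc))
  obtain ⟨t, ht⟩ := isCompact_univ.elim_finite_subcover V hVo
    fun x _ => Set.mem_iUnion.2 ⟨x, hxV x⟩
  refine ⟨⋃ i ∈ t, frontier (V i), t.finite_toSet.biUnion fun i _ => hVf i, fun x hx => ?_⟩
  obtain ⟨i, hi, hxi⟩ := Set.mem_iUnion₂.1 (ht (Set.mem_univ x))
  have hsub := isPreconnected_connectedComponentIn.subset_of_isOpen_of_disjoint_frontier
    (hVo i) ⟨x, mem_connectedComponentIn hx, hxi⟩ <|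
      Set.disjoint_left.2 fun y hy hyf =>
        connectedComponentIn_subset _ _ hy (Set.mem_biUnion hi hyf)
  calc Metric.diam (connectedComponentIn _ x)
      ≤ Metric.diam (Metric.ball i (c / 2)) :=
        Metric.diam_mono (hsub.trans (hVU i)) Metric.isBounded_ball
    _ ≤ 2 * (c / 2) := Metric.diam_ball (half_pos hc).le
    _ = c := by ring
end

section
/- Let G be a group acting on a set X, and let (A, B1, B2, g1, g2) be a semi ping pong with A nonempty. Then the subsemigroup of G generated by g1 and g2 is free on {g1, g2}; that is, any two distinct nonempty positive words in g1 and g2 represent distinct elements of G. -/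
section PingPong

variable {ι X G : Type*} [Group G] [MulAction G X] {A : Set X} {B : ι → Set X} {g : ι → G}

theorem list_prod_smul_mem (hB : ∀ i, B i ⊆ A) (hg : ∀ i, ∀ x ∈ A, g i • x ∈ B i)
    (w : List ι) {x : X} (hx : x ∈ A) : (w.map g).prod • x ∈ A := by
  induction w with
  | nil => simpa using hx
  | cons i w ih =>
    rw [List.map_cons, List.prod_cons, mul_smul]
    exact hB i (hg i _ ih)

theorem list_cons_prod_smul_mem (hB : ∀ i, B i ⊆ A) (hg : ∀ i, ∀ x ∈ A, g i • x ∈ B i)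
    (i : ι) (w : List ι) {x : X} (hx : x ∈ A) : ((i :: w).map g).prod • x ∈ B i := by
  rw [List.map_cons, List.prod_cons, mul_smul]
  exact hg i _ (list_prod_smul_mem hB hg w hx)

theorem list_cons_prod_ne_one [Nontrivial ι] (hA : A.Nonempty) (hB : ∀ i, B i ⊆ A)
    (hdisj : Pairwise fun i j => Disjoint (B i) (B j))
    (hg : ∀ i, ∀ x ∈ A, g i • x ∈ B i) (i : ι) (w : List ι) :
    ((i :: w).map g).prod ≠ 1 := by
  intro h
  obtain ⟨x, hx⟩ := hA
  obtain ⟨j, hj⟩ := exists_ne i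
  have hxj := hg j x hx
  have hxi := list_cons_prod_smul_mem hB hg i w (hB j hxj)
  rw [h, one_smul] at hxi
  exact Set.disjoint_left.mp (hdisj hj) hxj hxi

/-- The ping-pong lemma for free monoids: the players' positive words are determined by
the group elements they represent. -/
theorem list_map_prod_injective_of_semi_ping_pong [Nontrivial ι] (hA : A.Nonempty)
    (hB : ∀ i, B i ⊆ A) (hdisj : Pairwise fun i j => Disjoint (B i) (B j))
    (hg : ∀ i, ∀ x ∈ A, g i • x ∈ B i) :
    Function.Injective fun w : List ι => (w.map g).prod := by
  intro v
  induction v with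
  | nil =>
    rintro (_ | ⟨j, w⟩) h
    · rfl
    · exact absurd h.symm (list_cons_prod_ne_one hA hB hdisj hg j w)
  | cons i v ih =>
    rintro (_ | ⟨j, w⟩) h
    · exact absurd h (list_cons_prod_ne_one hA hB hdisj hg i v)
    · obtain rfl : i = j := by
        by_contra hij
        obtain ⟨x, hx⟩ := hA
        have hxj := list_cons_prod_smul_mem hB hg j w hx
        rw [← show ((i :: v).map g).prod = ((j :: w).map g).prod from h] at hxj
        exact Set.disjoint_left.mp (hdisj hij) (list_cons_prod_smul_mem hB hg i v hx) hxj
      rw [ih (by simpa using h)]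

end PingPong

/-- If `(A, B1, B2, g1, g2)` is a semi ping pong with `A` nonempty, then the
subsemigroup generated by `g1` and `g2` is free on `{g1, g2}`: distinct nonempty positive
words in `g1, g2` represent distinct elements of `G`. -/
theorem semi_ping_pong_gives_free_subsemigroup
    {X : Type*} {G : Type*} [Group G] [MulAction G X]
    (A B1 B2 : Set X) (g1 g2 : G)
    (hA : A.Nonempty) (hB1 : B1 ⊆ A) (hB2 : B2 ⊆ A) (hdisj : B1 ∩ B2 = ∅)
    (hg1 : (fun x => g1 • x) '' A ⊆ B1) (hg2 : (fun x => g2 • x) '' A ⊆ B2) :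
    ∀ w1 w2 : List (Fin 2), w1 ≠ [] → w2 ≠ [] → w1 ≠ w2 →
      (w1.map ![g1, g2]).prod ≠ (w2.map ![g1, g2]).prod := by
  intro w1 w2 _ _ hne h
  have hd : Disjoint B1 B2 := Set.disjoint_iff_inter_eq_empty.mpr hdisj
  refine hne (list_map_prod_injective_of_semi_ping_pong (B := ![B1, B2]) hA ?_ ?_ ?_ h)
  · exact Fin.forall_fin_two.mpr ⟨hB1, hB2⟩
  · intro i j hij
    fin_cases i <;> fin_cases j
    · exact absurd rfl hij
    · exact hd
    · exact hd.symm
    · exact absurd rfl hij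
  · exact Fin.forall_fin_two.mpr
      ⟨fun x hx => hg1 (Set.mem_image_of_mem _ hx), fun x hx => hg2 (Set.mem_image_of_mem _ hx)⟩
end

section
/- A nilpotent group contains no free noncommutative subsemigroup; that is, if G is a nilpotent group, then for any g1, g2 ∈ G there exist two distinct nonempty positive words in g1 and g2 that represent the same element of G. -/
/-- If two positive words with different first letters agree modulo the `k`-th term of the upper
central series, then some two positive words with different first letters are equal in `G`. -/
theorem exists_positive_words_prod_eq_of_mem_upperCentralSeries {G : Type*} [Group G]
    (f : Fin 2 → G) (k : ℕ) (u v : List (Fin 2))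
    (h : ((0 :: u).map f).prod * (((1 :: v).map f).prod)⁻¹ ∈ Subgroup.upperCentralSeries G k) :
    ∃ u' v' : List (Fin 2), ((0 :: u').map f).prod = ((1 :: v').map f).prod := by
  induction k generalizing u v with
  | zero =>
    rw [Subgroup.upperCentralSeries_zero, Subgroup.mem_bot, mul_inv_eq_one] at h
    exact ⟨u, v, h⟩
  | succ k ih =>
    apply ih (u ++ 1 :: v) (v ++ 0 :: u)
    rw [← List.cons_append, ← List.cons_append, List.map_append, List.map_append,
      List.prod_append, List.prod_append]
    convert Subgroup.mem_upperCentralSeries_succ_iff.mp h ((1 :: v).map f).prod using 1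
    group

/-- A nilpotent group contains no free noncommutative subsemigroup: for any
`g1 g2` in a nilpotent group, two distinct nonempty positive words in `g1, g2` represent
the same element. -/
theorem nilpotent_group_has_no_free_subsemigroup
    {G : Type*} [Group G] [Group.IsNilpotent G] (g1 g2 : G) :
    ∃ w1 w2 : List (Fin 2), w1 ≠ [] ∧ w2 ≠ [] ∧ w1 ≠ w2 ∧
      (w1.map ![g1, g2]).prod = (w2.map ![g1, g2]).prod := by
  obtain ⟨n, hn⟩ := Group.IsNilpotent.nilpotent G
  obtain ⟨u, v, h⟩ := exists_positive_words_prod_eq_of_mem_upperCentralSeries ![g1, g2] n [] []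
    (hn ▸ Subgroup.mem_top _)
  exact ⟨0 :: u, 1 :: v, by simp, by simp, by simp, h⟩
end

section
/- Let (X, d) be a metric space, let n be a positive integer, let ε > 0, and let e_1, …, e_n ∈ X. If S ⊆ X is a connected set contained in the union of the open balls B(e_i, ε/(2n)) for i = 1, …, n, then diam(S) ≤ ε. -/
/-- If a connected set `S` in a metric space is covered by the `n` open balls
of radius `ε/(2n)` centered at `e 0, …, e (n-1)`, then `diam S ≤ ε`. -/
theorem diam_le_of_connected_subset_union_balls
    {X : Type*} [MetricSpace X] (n : ℕ) (hn : 0 < n) (ε : ℝ) (hε : 0 < ε)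
    (e : Fin n → X) (S : Set X) (hconn : IsConnected S)
    (hsub : S ⊆ ⋃ i : Fin n, Metric.ball (e i) (ε / (2 * n))) :
    Metric.diam S ≤ ε := by
  refine Metric.diam_le_of_forall_dist_le hε.le fun x hx y hy => ?_
  -- The image of `S` under `dist x` is an interval containing `[0, dist x y]`, and it is covered
  -- by `n` balls of the real line, each of length `ε / n`.
  have hcover : Set.Icc 0 (dist x y) ⊆
      ⋃ i : Fin n, Metric.ball (dist x (e i)) (ε / (2 * n)) := by
    have hIcc : Set.Icc (dist x x) (dist x y) ⊆ dist x '' S :=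
      (hconn.isPreconnected.image _ (by fun_prop)).Icc_subset
        (Set.mem_image_of_mem _ hx) (Set.mem_image_of_mem _ hy)
    rw [dist_self] at hIcc
    refine hIcc.trans ?_
    rintro _ ⟨z, hz, rfl⟩
    obtain ⟨i, hi⟩ := Set.mem_iUnion.1 (hsub hz)
    exact Set.mem_iUnion.2 ⟨i, (dist_dist_dist_le_right x z (e i)).trans_lt hi⟩
  have hn' : (n : ℝ) ≠ 0 := by positivity
  rw [← ENNReal.ofReal_le_ofReal_iff hε.le]
  calc ENNReal.ofReal (dist x y)
      = MeasureTheory.volume (Set.Icc 0 (dist x y)) := by rw [Real.volume_Icc, sub_zero]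
    _ ≤ ∑ i : Fin n, MeasureTheory.volume (Metric.ball (dist x (e i)) (ε / (2 * n))) :=
        (MeasureTheory.measure_mono hcover).trans (MeasureTheory.measure_iUnion_fintype_le _ _)
    _ = ENNReal.ofReal ε := by
        simp only [Real.volume_ball, Finset.sum_const, Finset.card_univ, Fintype.card_fin]
        rw [← ENNReal.ofReal_nsmul, nsmul_eq_mul]
        congr 1
        field_simp
end

section
/- Let G be a group acting on a metric space (X, d), let A, B1, B2 ⊆ X and g1, g2 ∈ G satisfy: A is nonempty, B1 ⊆ A, B2 ⊆ A, g1(A) ⊆ B1, g2(A) ⊆ B2, and dist(B1, B2) ≥ ε for some ε > 0. Then for every positive integer m there is a finite set F ⊆ X with cardinality 2^m such that for any two distinct points x, y ∈ F there exists g ∈ G which is a product of at most m elements of {g1⁻¹, g2⁻¹} and satisfies d(g x, g y) ≥ ε. -/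
/-- The separated set of a semi ping pong can be chosen inside `A`: it consists of the images of
a point of `A` under the words of length `m` in `g1, g2`. -/
theorem exists_separated_finset_subset
    {X : Type*} [MetricSpace X] {G : Type*} [Group G] [MulAction G X]
    (A B1 B2 : Set X) (g1 g2 : G) (ε : ℝ) (hε : 0 < ε)
    (hA : A.Nonempty) (hB1 : B1 ⊆ A) (hB2 : B2 ⊆ A)
    (hg1 : ∀ a ∈ A, g1 • a ∈ B1) (hg2 : ∀ a ∈ A, g2 • a ∈ B2)
    (hdist : ∀ b1 ∈ B1, ∀ b2 ∈ B2, ε ≤ dist b1 b2) (m : ℕ) :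
    ∃ F : Finset X, (∀ x ∈ F, x ∈ A) ∧ F.card = 2 ^ m ∧
      ∀ x ∈ F, ∀ y ∈ F, x ≠ y →
        ∃ w : List G, w.length ≤ m ∧ (∀ s ∈ w, s = g1⁻¹ ∨ s = g2⁻¹) ∧
          ε ≤ dist (w.prod • x) (w.prod • y) := by
  classical
  induction m with
  | zero =>
    obtain ⟨a, ha⟩ := hA
    refine ⟨{a}, by simpa using ha, by simp, fun x hx y hy hxy => ?_⟩
    rw [Finset.mem_singleton] at hx hy
    exact absurd (hx.trans hy.symm) hxy
  | succ m ih =>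
    obtain ⟨F, hFA, hcard, hsep⟩ := ih
    have hdisj : Disjoint (F.image (g1 • ·)) (F.image (g2 • ·)) := by
      simp only [Finset.disjoint_left, Finset.mem_image]
      rintro _ ⟨x, hx, rfl⟩ ⟨y, hy, hxy⟩
      have := hdist _ (hg1 x (hFA x hx)) _ (hg2 y (hFA y hy))
      rw [hxy, dist_self] at this
      exact absurd this hε.not_ge
    have hpull : ∀ g : G, g⁻¹ = g1⁻¹ ∨ g⁻¹ = g2⁻¹ → ∀ x ∈ F, ∀ y ∈ F, g • x ≠ g • y →
        ∃ w : List G, w.length ≤ m + 1 ∧ (∀ s ∈ w, s = g1⁻¹ ∨ s = g2⁻¹) ∧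
          ε ≤ dist (w.prod • g • x) (w.prod • g • y) := by
      intro g hg x hx y hy hxy
      obtain ⟨w, hlen, hw, hd⟩ := hsep x hx y hy (fun h => hxy (by rw [h]))
      refine ⟨w ++ [g⁻¹], by simpa using hlen, fun s hs => ?_, by simpa [mul_smul] using hd⟩
      rcases List.mem_append.1 hs with h | h
      · exact hw s h
      · rwa [List.mem_singleton.1 h]
    refine ⟨F.image (g1 • ·) ∪ F.image (g2 • ·), ?_, ?_, ?_⟩
    · simp only [Finset.mem_union, Finset.mem_image]
      rintro _ (⟨x, hx, rfl⟩ | ⟨x, hx, rfl⟩)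
      · exact hB1 (hg1 x (hFA x hx))
      · exact hB2 (hg2 x (hFA x hx))
    · rw [Finset.card_union_of_disjoint hdisj,
        Finset.card_image_of_injective _ (MulAction.injective g1),
        Finset.card_image_of_injective _ (MulAction.injective g2), hcard]
      ring
    · simp only [Finset.mem_union, Finset.mem_image]
      rintro _ (⟨x, hx, rfl⟩ | ⟨x, hx, rfl⟩) _ (⟨y, hy, rfl⟩ | ⟨y, hy, rfl⟩) hxy
      · exact hpull g1 (Or.inl rfl) x hx y hy hxy
      · exact ⟨[], by simp, by simp,
          by simpa using hdist _ (hg1 x (hFA x hx)) _ (hg2 y (hFA y hy))⟩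
      · exact ⟨[], by simp, by simp,
          by simpa [dist_comm] using hdist _ (hg1 y (hFA y hy)) _ (hg2 x (hFA x hx))⟩
      · exact hpull g2 (Or.inr rfl) x hx y hy hxy


/-- A semi ping pong whose targets `B1, B2` are at distance `≥ ε` yields,
for every `m`, a set of `2^m` points that are pairwise `(m, ε)`-separated by products of
at most `m` elements of `{g1⁻¹, g2⁻¹}`. -/
theorem semi_ping_pong_gives_separated_sets
    {X : Type*} [MetricSpace X] {G : Type*} [Group G] [MulAction G X]
    (A B1 B2 : Set X) (g1 g2 : G) (ε : ℝ) (hε : 0 < ε)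
    (hA : A.Nonempty) (hB1 : B1 ⊆ A) (hB2 : B2 ⊆ A)
    (hg1 : (fun x => g1 • x) '' A ⊆ B1) (hg2 : (fun x => g2 • x) '' A ⊆ B2)
    (hdist : ∀ b1 ∈ B1, ∀ b2 ∈ B2, ε ≤ dist b1 b2)
    (m : ℕ) (hm : 0 < m) :
    ∃ F : Finset X, F.card = 2 ^ m ∧
      ∀ x ∈ F, ∀ y ∈ F, x ≠ y →
        ∃ g : G, (∃ w : List G, w.length ≤ m ∧
            (∀ s ∈ w, s = g1⁻¹ ∨ s = g2⁻¹) ∧ g = w.prod) ∧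
          ε ≤ dist (g • x) (g • y) := by
  obtain ⟨F, -, hcard, hsep⟩ := exists_separated_finset_subset A B1 B2 g1 g2 ε hε hA hB1 hB2
    (fun a ha => hg1 ⟨a, ha, rfl⟩) (fun a ha => hg2 ⟨a, ha, rfl⟩) hdist m
  refine ⟨F, hcard, fun x hx y hy hxy => ?_⟩
  obtain ⟨w, hlen, hw, hd⟩ := hsep x hx y hy hxy
  exact ⟨w.prod, ⟨w, hlen, hw, rfl⟩, hd⟩
end

section
/- Let X be a locally connected continuum and let G be a group acting on X by homeomorphisms such that the action is sensitive with sensitivity constant c > 0. Let A ⊆ X be a finite set such that every connected component of X \ A has diameter at most c. Then the closure of the union ⋃_{g ∈ G} g(A) has nonempty interior in X. -/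
/-- For a sensitive action (with sensitivity constant `c`) of a group `G` by
homeomorphisms on a locally connected continuum `X`, if `A` is a finite set such that every
connected component of `X \ A` has diameter at most `c`, then the closure of
`⋃ g ∈ G, g(A)` has nonempty interior. -/
theorem closure_orbit_of_cut_set_has_nonempty_interior
    {X : Type*} [MetricSpace X] [CompactSpace X] [ConnectedSpace X]
    [LocallyConnectedSpace X]
    {G : Type*} [Group G] [MulAction G X]
    (hcont : ∀ g : G, Continuous fun x : X => g • x)
    (c : ℝ) (hc : 0 < c)
    (hsens : ∀ U : Set X, IsOpen U → U.Nonempty →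
      ∃ g : G, c < Metric.diam ((fun x => g • x) '' U))
    (A : Set X) (hA : A.Finite)
    (hcomp : ∀ x ∈ Aᶜ, Metric.diam (connectedComponentIn Aᶜ x) ≤ c) :
    (interior (closure (⋃ g : G, (fun x => g • x) '' A))).Nonempty := by
  set O : Set X := closure (⋃ g : G, (fun x => g • x) '' A)
  obtain ⟨x, hx⟩ | hempty := Oᶜ.eq_empty_or_nonempty.symm
  · -- A component of the complement of the orbit closure contradicts sensitivity.
    exfalso
    obtain ⟨g, hg⟩ := hsens (connectedComponentIn Oᶜ x)
      isClosed_closure.isOpen_compl.connectedComponentIn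
      ⟨x, mem_connectedComponentIn hx⟩
    have hsub : (fun y => g • y) '' connectedComponentIn Oᶜ x ⊆ Aᶜ := by
      rintro _ ⟨y, hy, rfl⟩ hyA
      exact connectedComponentIn_subset _ _ hy
        (subset_closure (Set.mem_iUnion.2 ⟨g⁻¹, g • y, hyA, inv_smul_smul g y⟩))
    have hgx : g • x ∈ (fun y => g • y) '' connectedComponentIn Oᶜ x :=
      ⟨x, mem_connectedComponentIn hx, rfl⟩
    have hconn : IsPreconnected ((fun y => g • y) '' connectedComponentIn Oᶜ x) :=
      isPreconnected_connectedComponentIn.image _ (hcont g).continuousOn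
    have hle := Metric.diam_mono (hconn.subset_connectedComponentIn hgx hsub)
      (Metric.isBounded_of_compactSpace)
    exact absurd hg (not_lt.2 (hle.trans (hcomp _ (hsub hgx))))
  · rw [Set.compl_empty_iff.1 hempty, interior_univ]
    exact Set.univ_nonempty
end
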